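/- arXiv:2208.04455 — 2 statements merged into one kernel-verified Lean document; each statement's English description precedes it below -/
import Mathlib

section
/- Let R be a commutative noetherian ring and let X be an object of the derived category of R-modules such that each cohomology module H^i(X) is finitely generated and H^i(X) = 0 for all but finitely many integers i. Then there exist finitely many elements x_1, …, x_r of R such that, writing I = (x_1, …, x_r), the support of X (namely the union over all i of Supp_R H^i(X)) equals V(I), and for each j with 1 ≤ j ≤ r the morphism x_j · id_X : X → X (scalar multiplication by x_j) is the zero morphism in the derived category. -/
open CategoryTheory

universe w u

noncomputable section

open Limits Pretriangulated

section

variable {R : Type*} [CommRing R] {C : Type*} [Category* C] [Preadditive C] [Linear R C]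

/-- Being annihilated by a scalar is invariant under isomorphism. -/
lemma smul_id_eq_zero_of_iso {A B : C} (e : A ≅ B) {x : R} (h : x • 𝟙 A = 0) :
    x • 𝟙 B = 0 := by
  have : x • 𝟙 B = e.inv ≫ (x • 𝟙 A) ≫ e.hom := by simp
  rw [this, h, zero_comp, comp_zero]

/-- If `x` annihilates the first object of a distinguished triangle and `y` the third one,
then `x * y` annihilates the second one. -/
lemma mul_smul_id_eq_zero_of_distTriang [HasZeroObject C] [HasShift C ℤ]
    [∀ n : ℤ, (shiftFunctor C n).Additive] [Pretriangulated C]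
    (T : Triangle C) (hT : T ∈ distTriang C) {x y : R}
    (hx : x • 𝟙 T.obj₁ = 0) (hy : y • 𝟙 T.obj₃ = 0) :
    (x * y) • 𝟙 T.obj₂ = 0 := by
  obtain ⟨g, hg⟩ := Triangle.coyoneda_exact₂ T hT (y • 𝟙 T.obj₂) (by
    have : (y • 𝟙 T.obj₂) ≫ T.mor₂ = T.mor₂ ≫ (y • 𝟙 T.obj₃) := by simp
    rw [this, hy, comp_zero])
  have : x • (g ≫ T.mor₁) = g ≫ (x • 𝟙 T.obj₁) ≫ T.mor₁ := by simp
  rw [mul_smul, hg, this, hx, zero_comp, comp_zero]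

end

lemma HomologicalComplex.homologyMap_smul {R : Type*} [Semiring R] {C : Type*} [Category* C]
    [Preadditive C] [Linear R C] {ι : Type*} {c : ComplexShape ι} {K L : HomologicalComplex C c}
    (f : K ⟶ L) (r : R) (i : ι) [K.HasHomology i] [L.HasHomology i] :
    homologyMap (r • f) i = r • homologyMap f i :=
  ShortComplex.homologyMap_smul ((shortComplexFunctor C c i).map f) r

namespace CochainComplex

variable {C : Type*} [Category* C] [Abelian C] (K : CochainComplex C ℤ)

lemma isGE_truncLE (a n : ℤ) [K.IsGE a] : (K.truncLE n).IsGE a := by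
  rw [isGE_iff]
  intro i hi
  rw [HomologicalComplex.exactAt_iff_isZero_homology]
  by_cases h : i ≤ n
  · have := K.quasiIsoAt_ιTruncLE n i h
    exact (K.isZero_of_isGE a i hi).of_iso (isoOfQuasiIsoAt (K.ιTruncLE n) i)
  · exact (K.truncLE n).isZero_of_isLE n i (by lia)

lemma isLE_truncGE (b n : ℤ) [K.IsLE b] : (K.truncGE n).IsLE b := by
  rw [isLE_iff]
  intro i hi
  rw [HomologicalComplex.exactAt_iff_isZero_homology]
  by_cases h : n ≤ i
  · have := K.quasiIsoAt_πTruncGE n i h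
    exact (K.isZero_of_isLE b i hi).of_iso (isoOfQuasiIsoAt (K.πTruncGE n) i).symm
  · exact (K.truncGE n).isZero_of_isGE n i (by lia)

end CochainComplex

namespace DerivedCategory

variable {R : Type*} [CommRing R] {C : Type*} [Category* C] [Abelian C] [Linear R C]
  [HasDerivedCategory.{w} C]

/-- A scalar annihilating the cohomology of a complex concentrated in a single degree
annihilates this complex in the derived category. -/
lemma smul_id_Q_obj_eq_zero_of_isGE_of_isLE (K : CochainComplex C ℤ) (a : ℤ) [K.IsGE a] [K.IsLE a]
    {x : R} (hx : x • 𝟙 (K.homology a) = 0) : x • 𝟙 (Q.obj K) = 0 := by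
  obtain ⟨Y, ⟨e⟩⟩ := exists_iso_singleFunctor_obj_of_isGE_of_isLE (Q.obj K) a
  let e' : K.homology a ≅ Y :=
    ((homologyFunctorFactors C a).app K).symm ≪≫ (homologyFunctor C a).mapIso e ≪≫
      (homologyFunctor C a).mapIso ((singleFunctorIsoCompQ C a).app Y) ≪≫
      (homologyFunctorFactors C a).app _ ≪≫
      (HomologicalComplex.homologyFunctorSingleIso C (ComplexShape.up ℤ) a).app Y
  refine smul_id_eq_zero_of_iso e.symm ?_
  rw [← CategoryTheory.Functor.map_id, ← Functor.map_smul, smul_id_eq_zero_of_iso e' hx, Functor.map_zero]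

/-- If `K` is cohomologically concentrated in degrees `a, …, a + n`, a product of scalars
annihilating its cohomology objects annihilates `K` in the derived category. -/
lemma prod_smul_id_Q_obj_eq_zero (a : ℤ) (x : ℤ → R) (n : ℕ) (K : CochainComplex C ℤ)
    [K.IsGE a] [K.IsLE (a + n)] (hx : ∀ i, x i • 𝟙 (K.homology i) = 0) :
    (∏ i ∈ Finset.range (n + 1), x (a + i)) • 𝟙 (Q.obj K) = 0 := by
  induction n generalizing K with
  | zero =>
    have : K.IsLE a := by simpa using ‹K.IsLE (a + (0 : ℕ))›
    simpa using smul_id_Q_obj_eq_zero_of_isGE_of_isLE K a (hx a)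
  | succ n ih =>
    let b := a + n
    have hb : b + 1 = a + (n + 1 : ℕ) := by simp [b, add_assoc]
    have : K.IsLE (b + 1) := by rwa [hb]
    have := K.isGE_truncLE a b
    have := K.isLE_truncGE (b + 1) (b + 1)
    have hle : (∏ i ∈ Finset.range (n + 1), x (a + i)) • 𝟙 (Q.obj (K.truncLE b)) = 0 := by
      have : (K.truncLE b).IsLE (a + n) := inferInstanceAs ((K.truncLE b).IsLE b)
      refine ih (K.truncLE b) fun i ↦ ?_
      by_cases hi : i ≤ b
      · have := K.quasiIsoAt_ιTruncLE b i hi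
        exact smul_id_eq_zero_of_iso (isoOfQuasiIsoAt (K.ιTruncLE b) i).symm (hx i)
      · exact ((K.truncLE b).isZero_of_isLE b i (by lia)).eq_of_src _ _
    have hge : x (b + 1) • 𝟙 (Q.obj (K.truncGE (b + 1))) = 0 :=
      smul_id_Q_obj_eq_zero_of_isGE_of_isLE _ (b + 1)
        (smul_id_eq_zero_of_iso (isoOfQuasiIsoAt (K.πTruncGE (b + 1)) (b + 1)) (hx _))
    rw [Finset.prod_range_succ, ← hb]
    exact mul_smul_id_eq_zero_of_distTriang _
      (triangleOfSES_distinguished (K.shortComplexTruncLE_shortExact b)) hle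
      (smul_id_eq_zero_of_iso
        (asIso (Q.map (K.shortComplexTruncLEX₃ToTruncGE b (b + 1) rfl))).symm hge)

/-- A scalar annihilating a complex in the derived category annihilates its cohomology. -/
lemma smul_id_homology_eq_zero (K : CochainComplex C ℤ) {x : R} (hx : x • 𝟙 (Q.obj K) = 0)
    (i : ℤ) : x • 𝟙 (K.homology i) = 0 := by
  have h : Q.map (x • 𝟙 K) = 0 := by rw [Functor.map_smul, CategoryTheory.Functor.map_id, hx]
  have h' : HomologicalComplex.homologyMap (x • 𝟙 K) i = 0 := by
    have nat := homologyFunctorFactors_hom_naturality (x • 𝟙 K) i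
    rw [h, Functor.map_zero, zero_comp] at nat
    exact (cancel_epi ((homologyFunctorFactors C i).hom.app K)).1 (nat.symm.trans comp_zero.symm)
  rwa [HomologicalComplex.homologyMap_smul, HomologicalComplex.homologyMap_id] at h'

end DerivedCategory

lemma ModuleCat.smul_id_eq_zero_iff {R : Type u} [CommRing R] (M : ModuleCat.{u} R) (x : R) :
    x • 𝟙 M = 0 ↔ x ∈ Module.annihilator R M := by
  rw [Module.mem_annihilator]
  constructor
  · intro h m
    exact ConcreteCategory.congr_hom h m
  · intro h
    ext m
    exact h m

/-- For a bounded complex `X` of `R`-modules with finitely generated cohomology over a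
noetherian ring `R`, there are finitely many elements `x_1, …, x_r` of `R` such that the
support of `X`, i.e. `⋃ i, Supp H^i(X)`, equals `V((x_1, …, x_r))` and multiplication by each
`x_j` is the zero endomorphism of `X` in the derived category of `R`-modules. -/
theorem exists_generators_support_eq_and_smul_id_eq_zero
    (R : Type u) [CommRing R] [IsNoetherianRing R]
    [HasDerivedCategory.{w} (ModuleCat.{u} R)]
    (X : CochainComplex (ModuleCat.{u} R) ℤ)
    (hfg : ∀ i : ℤ, Module.Finite R (X.homology i))
    (hbd : {i : ℤ | ¬ Subsingleton (X.homology i)}.Finite) :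
    ∃ (r : ℕ) (x : Fin r → R),
      (⋃ i : ℤ, Module.support R (X.homology i)) =
        PrimeSpectrum.zeroLocus ((Ideal.span (Set.range x) : Ideal R) : Set R) ∧
      ∀ j : Fin r, DerivedCategory.Q.map ((x j) • 𝟙 X) = 0 := by
  let J : Ideal R := LinearMap.ker (LinearMap.toSpanSingleton R _ (𝟙 (DerivedCategory.Q.obj X)))
  have mem_J (y : R) : y ∈ J ↔ y • 𝟙 (DerivedCategory.Q.obj X) = 0 := by simp [J]
  obtain ⟨r, x, hxJ⟩ := Submodule.fg_iff_exists_fin_generating_family.1 (IsNoetherian.noetherian J)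
  replace hxJ : Ideal.span (Set.range x) = J := hxJ
  refine ⟨r, x, ?_, fun j ↦ ?_⟩
  · rw [hxJ]
    ext p
    simp only [Set.mem_iUnion, Module.mem_support_iff_of_finite, PrimeSpectrum.mem_zeroLocus,
      SetLike.coe_subset_coe]
    constructor
    · rintro ⟨i, hi⟩ y hy
      exact hi ((ModuleCat.smul_id_eq_zero_iff _ _).1
        (DerivedCategory.smul_id_homology_eq_zero X ((mem_J y).1 hy) i))
    · intro hp
      by_contra! hcon
      choose y hy hyp using fun i ↦ SetLike.not_le_iff_exists.1 (hcon i)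
      obtain ⟨a, ha⟩ := hbd.bddBelow
      obtain ⟨b, hb⟩ := hbd.bddAbove
      have isZero (i : ℤ) (hi : i < a ∨ b < i) : IsZero (X.homology i) := by
        rw [ModuleCat.isZero_iff_subsingleton]
        by_contra h
        have := ha h
        have := hb h
        lia
      have : X.IsGE a := by
        rw [CochainComplex.isGE_iff]
        exact fun i hi ↦ (X.exactAt_iff_isZero_homology i).2 (isZero i (.inl hi))
      have : X.IsLE (a + (b - a).toNat) := by
        rw [CochainComplex.isLE_iff]
        exact fun i hi ↦ (X.exactAt_iff_isZero_homology i).2 (isZero i (.inr (by lia)))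
      have hprod := hp ((mem_J _).2 (DerivedCategory.prod_smul_id_Q_obj_eq_zero a y (b - a).toNat X
        fun i ↦ (ModuleCat.smul_id_eq_zero_iff _ _).2 (hy i)))
      obtain ⟨i, -, hi⟩ := p.isPrime.prod_mem_iff.1 hprod
      exact hyp _ hi
  · rw [Functor.map_smul, CategoryTheory.Functor.map_id, ← mem_J, ← hxJ]
    exact Ideal.subset_span ⟨j, rfl⟩
end
end

section
/- Let R be a commutative noetherian ring. A map f : Spec R → ℤ ∪ {±∞} is a t-function on Spec R if and only if for every saturated inclusion p ⊊ q of prime ideals of R (i.e., p ⊊ q and there is no prime strictly between p and q) the inequalities f(p) ≤ f(q) ≤ f(p) + 1 hold. -/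
open CategoryTheory

universe w u

noncomputable section

/-- The depth of a module `N` over a noetherian local ring `A`, defined as
`inf { i | Ext_A^i(k, N) ≠ 0 }` where `k` is the residue field of `A`
(the infimum of the empty set being `∞`). -/
def moduleDepth (A : Type u) [CommRing A] [IsLocalRing A]
    (N : Type u) [AddCommGroup N] [Module A N] : ℕ∞ :=
  sInf {i : ℕ∞ | ∃ m : ℕ, i = m ∧
    Nontrivial (((Ext A (ModuleCat.{u} A) m).obj
      (Opposite.op (ModuleCat.of A (IsLocalRing.ResidueField A)))).obj (ModuleCat.of A N))}

/-- `height (p/q)`: the supremum of the lengths of chains of primes between `q` and `p`. -/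
def relHeight {R : Type u} [CommRing R] (q p : PrimeSpectrum R) : ℕ∞ :=
  ⨆ (c : LTSeries (PrimeSpectrum R)) (_ : c.head = q ∧ c.last = p), (c.length : ℕ∞)

/-- The depth of the localized module `M_q` over the local ring `R_q`. -/
def localizedDepth {R : Type u} [CommRing R] (q : PrimeSpectrum R)
    (M : Type u) [AddCommGroup M] [Module R M] : ℕ∞ :=
  moduleDepth (Localization.AtPrime q.asIdeal) (LocalizedModule q.asIdeal.primeCompl M)

/-- The canonical embedding of `ℕ ∪ {∞}` into `ℤ ∪ {∞}`. -/
def enatToWithTopInt : ℕ∞ → WithTop ℤ := WithTop.map (Nat.cast : ℕ → ℤ)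

/-- The canonical embedding of `ℕ ∪ {∞}` into `ℤ ∪ {±∞}`. -/
def enatToE : ℕ∞ → WithTop (WithBot ℤ) := WithTop.map (fun m : ℕ => (m : WithBot ℤ))

/-- A `t`-function on `Spec R`: a map `f : Spec R → ℤ ∪ {±∞}` such that
`f(p) ≤ f(q) ≤ f(p) + height (q/p)` for all inclusions `p ⊆ q` of primes. -/
def IsTFunction {R : Type u} [CommRing R] (f : PrimeSpectrum R → WithTop (WithBot ℤ)) : Prop :=
  ∀ p q : PrimeSpectrum R, p ≤ q → f p ≤ f q ∧ f q ≤ f p + enatToE (relHeight p q)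

/-- Primes of a noetherian ring satisfy the ascending chain condition. -/
lemma PrimeSpectrum.wellFoundedGT_of_isNoetherianRing (R : Type u) [CommRing R]
    [IsNoetherianRing R] : WellFoundedGT (PrimeSpectrum R) :=
  StrictMono.wellFoundedGT (f := PrimeSpectrum.asIdeal) fun _ _ h => h

/-- Primes of a noetherian ring satisfy the descending chain condition. -/
lemma PrimeSpectrum.wellFoundedLT_of_isNoetherianRing (R : Type u) [CommRing R]
    [IsNoetherianRing R] : WellFoundedLT (PrimeSpectrum R) :=
  StrictMono.wellFoundedLT (f := fun p : PrimeSpectrum R => p.asIdeal.height)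
    fun _ _ h => Ideal.height_strict_mono_of_isPrime h

lemma enatToE_mono : Monotone enatToE :=
  WithTop.monotone_map_iff.2 fun _ _ h => by exact_mod_cast h

lemma enatToE_natCast_succ (n : ℕ) :
    enatToE ((n + 1 : ℕ) : ℕ∞) =
      enatToE (n : ℕ∞) + (((1 : ℤ) : WithBot ℤ) : WithTop (WithBot ℤ)) := by
  change (((n + 1 : ℕ) : WithBot ℤ) : WithTop (WithBot ℤ)) =
    ((n : WithBot ℤ) : WithTop (WithBot ℤ)) + (((1 : ℤ) : WithBot ℤ) : WithTop (WithBot ℤ))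
  push_cast
  rfl

lemma length_le_relHeight {R : Type u} [CommRing R] (c : LTSeries (PrimeSpectrum R)) :
    (c.length : ℕ∞) ≤ relHeight c.head c.last :=
  le_iSup₂_of_le c ⟨rfl, rfl⟩ le_rfl

lemma relHeight_le_one_of_covBy {R : Type u} [CommRing R] {p q : PrimeSpectrum R} (h : p ⋖ q) :
    relHeight p q ≤ 1 := by
  refine iSup₂_le fun c hc => ?_
  by_contra! hlt
  have hlen : 1 < c.length := by exact_mod_cast hlt
  refine h.2 (c := c ⟨1, by omega⟩) ?_ ?_
  · rw [← hc.1]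
    exact c.strictMono (Fin.mk_lt_mk.2 Nat.zero_lt_one)
  · rw [← hc.2]
    exact c.strictMono (Fin.mk_lt_mk.2 hlen)

/-- If `f` increases by at most one along saturated inclusions, then any inclusion of primes in a
noetherian ring is joined by a chain whose length bounds the increase of `f`. -/
lemma exists_ltSeries_le_add_length {R : Type u} [CommRing R] [IsNoetherianRing R]
    {f : PrimeSpectrum R → WithTop (WithBot ℤ)}
    (hf : ∀ p q : PrimeSpectrum R, p ⋖ q →
      f p ≤ f q ∧ f q ≤ f p + (((1 : ℤ) : WithBot ℤ) : WithTop (WithBot ℤ)))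
    {p q : PrimeSpectrum R} (hpq : p ≤ q) :
    ∃ c : LTSeries (PrimeSpectrum R), c.head = p ∧ c.last = q ∧
      f p ≤ f q ∧ f q ≤ f p + enatToE (c.length : ℕ∞) := by
  have := PrimeSpectrum.wellFoundedGT_of_isNoetherianRing R
  have := PrimeSpectrum.wellFoundedLT_of_isNoetherianRing R
  induction q using WellFoundedLT.induction with
  | ind q ih =>
    obtain rfl | hlt := hpq.eq_or_lt
    · exact ⟨RelSeries.singleton _ p, rfl, rfl, le_rfl, (add_zero (f p)).ge⟩
    · obtain ⟨r, hpr, hrq⟩ := exists_le_covBy_of_lt hlt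
      obtain ⟨c, hhead, hlast, hle, hle_add⟩ := ih r hrq.lt hpr
      obtain ⟨hrq_le, hrq_add⟩ := hf r q hrq
      refine ⟨c.snoc q (hlast ▸ hrq.lt), by simpa using hhead, by simp, hle.trans hrq_le, ?_⟩
      rw [RelSeries.snoc_length, enatToE_natCast_succ, ← add_assoc]
      exact hrq_add.trans (add_le_add_left hle_add _)

/-- A map `f : Spec R → ℤ ∪ {±∞}` is a `t`-function if and only if for every saturated
inclusion `p ⊊ q` of primes one has `f(p) ≤ f(q) ≤ f(p) + 1`. -/
theorem isTFunction_iff_saturated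
    (R : Type u) [CommRing R] [IsNoetherianRing R]
    (f : PrimeSpectrum R → WithTop (WithBot ℤ)) :
    IsTFunction f ↔ ∀ p q : PrimeSpectrum R, p ⋖ q →
      f p ≤ f q ∧ f q ≤ f p + (((1 : ℤ) : WithBot ℤ) : WithTop (WithBot ℤ)) := by
  refine ⟨fun hf p q hpq => ⟨(hf p q hpq.le).1, (hf p q hpq.le).2.trans ?_⟩, fun hf p q hpq => ?_⟩
  · exact add_le_add_right (enatToE_mono (relHeight_le_one_of_covBy hpq)) (f p)
  · obtain ⟨c, rfl, rfl, hle, hle_add⟩ := exists_ltSeries_le_add_length hf hpq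
    exact ⟨hle, hle_add.trans (add_le_add_right (enatToE_mono (length_le_relHeight c)) _)⟩
end
end
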